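/- Let F be a class of functions X → [0,1] with t-fat-shattering dimension d(t). There exist universal constants c, c' ∈ (0,∞) such that for all η, β ∈ (0,1), the β-covering number of F under the pseudometric ρ_η(f,g) = P_{2m}(x : |f(x)−g(x)| > η) satisfies N_η(β) ≤ (2/(ηβ))^{c·d(c'ηβ)}. -/

import Mathlib

open scoped ENNReal

/-- The empirical pseudometric ρ_η(f,g) = P_N(x : |f(x) − g(x)| > η) induced by
the sample `w` of `N` points. -/
noncomputable def empDist {X : Type*} (N : ℕ) (w : Fin N → X) (η : ℝ)
    (f g : X → ℝ) : ℝ :=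
  (((Finset.univ : Finset (Fin N)).filter fun j => η < |f (w j) - g (w j)|).card : ℝ) / N

/-- The β-covering number of `F` under the pseudometric `ρ`. -/
noncomputable def covN {X : Type*} (F : Set (X → ℝ))
    (ρ : (X → ℝ) → (X → ℝ) → ℝ) (β : ℝ) : ℝ≥0∞ :=
  sInf {c : ℝ≥0∞ | ∃ G : Finset (X → ℝ), (G.card : ℝ≥0∞) = c ∧
    ∀ f ∈ F, ∃ g ∈ G, ρ f g ≤ β}

/-- `F` t-fat-shatters some `k` points. -/
def FatShattered {X : Type*} (F : Set (X → ℝ)) (t : ℝ) (k : ℕ) : Prop :=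
  ∃ x : Fin k → X, ∃ r : Fin k → ℝ, ∀ b : Fin k → Bool,
    ∃ f ∈ F, ∀ i, (b i = true → r i + t ≤ f (x i)) ∧
      (b i = false → f (x i) ≤ r i - t)

/-- Discrete shattering of a partial assignment of levels. -/
def Shat {α ι : Type*} {q : ℕ} (v : α → ι → Fin q) (A : Finset α)
    (p : ι → Option (Fin q)) : Prop :=
  ∀ b : ι → Bool, ∃ f ∈ A, ∀ i j, p i = some j →
    (b i = true → j < v f i) ∧ (b i = false → v f i < j)

open Classical in
/-- The number of shattered partial assignments. -/
noncomputable def SN {α ι : Type*} [Fintype ι] {q : ℕ} (v : α → ι → Fin q)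
    (A : Finset α) : ℕ :=
  ((Finset.univ : Finset (ι → Option (Fin q))).filter fun p => Shat v A p).card

lemma Shat.mono {α ι : Type*} {q : ℕ} {v : α → ι → Fin q} {A B : Finset α}
    (h : A ⊆ B) {p : ι → Option (Fin q)} (hp : Shat v A p) : Shat v B p := by
  intro b
  obtain ⟨f, hf, h2⟩ := hp b
  exact ⟨f, h hf, h2⟩

open Classical in
lemma SN_add {α ι : Type*} [Fintype ι] {q : ℕ} (v : α → ι → Fin q)
    (A B C : Finset α) (hB : B ⊆ A) (hC : C ⊆ A) (i : ι) (j : Fin q)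
    (hBj : ∀ f ∈ B, v f i < j) (hCj : ∀ f ∈ C, j < v f i) :
    SN v B + SN v C ≤ SN v A := by
  unfold SN
  set P := (Finset.univ : Finset (ι → Option (Fin q))).filter fun p => Shat v B p with hP
  set Q := (Finset.univ : Finset (ι → Option (Fin q))).filter fun p => Shat v C p with hQ
  set R := (P ∩ Q).image (fun p => Function.update p i (some j)) with hR
  have hnone : ∀ p ∈ P ∩ Q, p i = none := by
    intro p hp
    simp only [hP, hQ, Finset.mem_inter, Finset.mem_filter, Finset.mem_univ, true_and] at hp
    by_contra hne
    obtain ⟨j', hj'⟩ := Option.ne_none_iff_exists'.1 hne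
    obtain ⟨f, hf, h1⟩ := hp.1 (fun _ => true)
    obtain ⟨g, hg, h2⟩ := hp.2 (fun _ => false)
    have a1 := (h1 i j' hj').1 rfl
    have a2 := (h2 i j' hj').2 rfl
    have a3 := hBj f hf
    have a4 := hCj g hg
    exact absurd (a1.trans (a3.trans (a4.trans a2))) (lt_irrefl _)
  have hRcard : R.card = (P ∩ Q).card := by
    apply Finset.card_image_of_injOn
    intro p hp p' hp' heq
    have e1 := hnone p hp
    have e2 := hnone p' hp'
    funext k
    by_cases hk : k = i
    · subst hk; rw [e1, e2]
    · have := congrFun heq k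
      simpa [Function.update_of_ne hk] using this
  have hdisj : Disjoint (P ∪ Q) R := by
    rw [Finset.disjoint_left]
    intro p hp hpR
    obtain ⟨p0, _, rfl⟩ := Finset.mem_image.1 hpR
    rcases Finset.mem_union.1 hp with h | h
    · obtain ⟨f, hf, h1⟩ := (Finset.mem_filter.1 h).2 (fun _ => true)
      have := (h1 i j (by simp)).1 rfl
      exact absurd (this.trans (hBj f hf)) (lt_irrefl _)
    · obtain ⟨f, hf, h1⟩ := (Finset.mem_filter.1 h).2 (fun _ => false)
      have := (h1 i j (by simp)).2 rfl
      exact absurd (this.trans (hCj f hf)) (lt_irrefl _)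
  have hsub : (P ∪ Q) ∪ R ⊆
      (Finset.univ : Finset (ι → Option (Fin q))).filter fun p => Shat v A p := by
    intro p hp
    rw [Finset.mem_filter]
    refine ⟨Finset.mem_univ _, ?_⟩
    rcases Finset.mem_union.1 hp with h | h
    · rcases Finset.mem_union.1 h with h | h
      · exact (Finset.mem_filter.1 h).2.mono hB
      · exact (Finset.mem_filter.1 h).2.mono hC
    · obtain ⟨p0, hp0, rfl⟩ := Finset.mem_image.1 h
      have hn := hnone p0 hp0
      have h1 := (Finset.mem_filter.1 (Finset.mem_inter.1 hp0).1).2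
      have h2 := (Finset.mem_filter.1 (Finset.mem_inter.1 hp0).2).2
      intro b
      cases hb : b i with
      | false =>
        obtain ⟨f, hf, hf2⟩ := h1 b
        refine ⟨f, hB hf, fun k l hkl => ?_⟩
        by_cases hk : k = i
        · subst hk
          simp only [Function.update_self, Option.some.injEq] at hkl
          subst hkl
          exact ⟨fun h => by simp [hb] at h, fun _ => hBj f hf⟩
        · rw [Function.update_of_ne hk] at hkl
          exact hf2 k l hkl
      | true =>
        obtain ⟨f, hf, hf2⟩ := h2 b
        refine ⟨f, hC hf, fun k l hkl => ?_⟩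
        by_cases hk : k = i
        · subst hk
          simp only [Function.update_self, Option.some.injEq] at hkl
          subst hkl
          exact ⟨fun _ => hCj f hf, fun h => by simp [hb] at h⟩
        · rw [Function.update_of_ne hk] at hkl
          exact hf2 k l hkl
  calc P.card + Q.card = (P ∪ Q).card + (P ∩ Q).card := (Finset.card_union_add_card_inter P Q).symm
    _ = ((P ∪ Q) ∪ R).card := by rw [Finset.card_union_of_disjoint hdisj, hRcard]
    _ ≤ _ := Finset.card_le_card hsub

/-- Number of (coordinate, level) pairs strictly between. -/
def DN {α ι : Type*} [Fintype ι] {q : ℕ} (v : α → ι → Fin q) (f g : α) : ℕ :=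
  ∑ i : ι, ∑ j : Fin q, if v f i < j ∧ j < v g i then 1 else 0

lemma exists_split {α ι : Type*} [Fintype ι] {q : ℕ} (v : α → ι → Fin q)
    (A : Finset α) (hA : 2 ≤ A.card)
    (H : ∀ f ∈ A, ∀ g ∈ A, f ≠ g → 4 * Fintype.card ι < DN v f g + DN v g f) :
    ∃ i : ι, ∃ j : Fin q,
      (A.filter fun f => v f i = j).card * A.card <
        (A.filter fun f => v f i < j).card * (A.filter fun f => j < v f i).card := by
  classical
  by_contra hcon
  push Not at hcon
  set n := Fintype.card ι with hn
  have e1 : ∑ f ∈ A, ∑ g ∈ A, DN v f g = ∑ i : ι, ∑ j : Fin q,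
      (A.filter fun f => v f i < j).card * (A.filter fun f => j < v f i).card := by
    have : ∀ (i : ι) (j : Fin q),
      (A.filter fun f => v f i < j).card * (A.filter fun f => j < v f i).card
        = ∑ f ∈ A, ∑ g ∈ A, if v f i < j ∧ j < v g i then 1 else 0 := by
      intro i j
      rw [Finset.card_filter, Finset.card_filter, Finset.sum_mul_sum]
      refine Finset.sum_congr rfl fun f _ => Finset.sum_congr rfl fun g _ => ?_
      by_cases h1 : v f i < j <;> by_cases h2 : j < v g i <;> simp [h1, h2]
    simp_rw [this]
    unfold DN
    rw [Finset.sum_congr rfl (fun f _ => Finset.sum_comm), Finset.sum_comm]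
    refine Finset.sum_congr rfl fun i _ => ?_
    rw [Finset.sum_congr rfl (fun f _ => Finset.sum_comm), Finset.sum_comm]
  have e2 : ∑ i : ι, ∑ j : Fin q, (A.filter fun f => v f i = j).card * A.card
      = n * A.card * A.card := by
    have : ∀ i : ι, ∑ j : Fin q, (A.filter fun f => v f i = j).card * A.card
        = A.card * A.card := by
      intro i
      rw [← Finset.sum_mul]
      congr 1
      exact (Finset.card_eq_sum_card_fiberwise (f := fun f => v f i) (t := Finset.univ)
        (by intro x _; simp)).symm
    simp_rw [this]
    simp [hn, mul_assoc]
  have e3 : ∑ f ∈ A, ∑ g ∈ A, DN v f g ≤ n * A.card * A.card := by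
    rw [e1, ← e2]
    exact Finset.sum_le_sum fun i _ => Finset.sum_le_sum fun j _ => hcon i j
  have e4 : ∑ f ∈ A, ∑ g ∈ A, (DN v f g + DN v g f) = 2 * ∑ f ∈ A, ∑ g ∈ A, DN v f g := by
    simp_rw [Finset.sum_add_distrib]
    rw [Finset.sum_comm (f := fun f g => DN v g f)]
    ring
  have e5 : A.card * ((A.card - 1) * (4 * n + 1)) ≤ ∑ f ∈ A, ∑ g ∈ A, (DN v f g + DN v g f) := by
    rw [← smul_eq_mul]
    refine Finset.card_nsmul_le_sum _ _ _ fun f hf => ?_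
    rw [← Finset.card_erase_of_mem hf, ← smul_eq_mul]
    refine (Finset.card_nsmul_le_sum _ (fun g => DN v f g + DN v g f) _ fun g hg => ?_).trans
      (Finset.sum_le_sum_of_subset (Finset.erase_subset f A))
    have := Finset.mem_erase.1 hg
    exact H f hf g this.2 this.1.symm
  obtain ⟨a, ha⟩ : ∃ a, A.card = a + 2 := ⟨A.card - 2, by omega⟩
  rw [e4] at e5
  rw [ha] at e5 e3
  have : a + 2 - 1 = a + 1 := by omega
  rw [this] at e5
  nlinarith [Nat.zero_le (n * a), Nat.zero_le (n * a * a), Nat.zero_le (a * a)]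

lemma card_le_SN_sq {α ι : Type*} [Fintype ι] {q : ℕ} (v : α → ι → Fin q) :
    ∀ (k : ℕ) (A : Finset α), A.card = k →
    (∀ f ∈ A, ∀ g ∈ A, f ≠ g → 4 * Fintype.card ι < DN v f g + DN v g f) →
    A.card ≤ SN v A ^ 2 := by
  classical
  intro k
  induction k using Nat.strong_induction_on with
  | _ k ih =>
  intro A hk H
  rcases Nat.lt_or_ge A.card 2 with h2 | h2
  · rcases Finset.eq_empty_or_nonempty A with rfl | ⟨f, hf⟩
    · simp
    · have : 0 < SN v A := by
        unfold SN
        rw [Finset.card_pos]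
        refine ⟨fun _ => none, ?_⟩
        simp only [Finset.mem_filter, Finset.mem_univ, true_and]
        intro b
        exact ⟨f, hf, by simp⟩
      have := Nat.one_le_pow 2 _ this
      omega
  · obtain ⟨i, j, hij⟩ := exists_split v A h2 H
    set B := A.filter fun f => v f i < j with hB
    set C := A.filter fun f => j < v f i with hC
    set E := A.filter fun f => v f i = j with hE
    have hsum : A.card = B.card + C.card + E.card := by
      rw [hB, hC, hE, Finset.card_filter, Finset.card_filter, Finset.card_filter,
        ← Finset.sum_add_distrib, ← Finset.sum_add_distrib, Finset.card_eq_sum_ones]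
      refine Finset.sum_congr rfl fun f _ => ?_
      rcases lt_trichotomy (v f i) j with h | h | h
      · simp [h, h.ne, h.not_gt]
      · simp [h]
      · simp [h, h.ne', h.not_gt]
    have hBpos : 0 < B.card := by
      rcases Nat.eq_zero_or_pos B.card with h | h
      · rw [h] at hij; simp at hij
      · exact h
    have hCpos : 0 < C.card := by
      rcases Nat.eq_zero_or_pos C.card with h | h
      · rw [h] at hij; simp at hij
      · exact h
    have sB : B ⊆ A := Finset.filter_subset _ _
    have sC : C ⊆ A := Finset.filter_subset _ _
    have iB := ih B.card (by omega) B rfl (fun f hf g hg => H f (sB hf) g (sB hg))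
    have iC := ih C.card (by omega) C rfl (fun f hf g hg => H f (sC hf) g (sC hg))
    have hadd := SN_add v A B C sB sC i j (fun f hf => (Finset.mem_filter.1 hf).2)
      (fun f hf => (Finset.mem_filter.1 hf).2)
    have hE2 : E.card ≤ SN v B * SN v C := by
      have h1 : E.card * E.card ≤ (SN v B * SN v C) * (SN v B * SN v C) := by
        calc E.card * E.card ≤ E.card * A.card := Nat.mul_le_mul_left _ (by omega)
          _ ≤ B.card * C.card := hij.le
          _ ≤ SN v B ^ 2 * SN v C ^ 2 := Nat.mul_le_mul iB iC
          _ = _ := by ring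
      exact Nat.mul_self_le_mul_self_iff.1 h1
    calc A.card = B.card + C.card + E.card := hsum
      _ ≤ SN v B ^ 2 + SN v C ^ 2 + 2 * (SN v B * SN v C) := by omega
      _ = (SN v B + SN v C) ^ 2 := by ring
      _ ≤ _ := Nat.pow_le_pow_left hadd 2

open Classical in
lemma SN_le_of_supp {α ι : Type*} [Fintype ι] {q : ℕ} (v : α → ι → Fin q)
    (A : Finset α) (d : ℕ) (lam : ℝ) (h0 : 0 < lam) (h1 : lam ≤ 1)
    (hd : ∀ p, Shat v A p → (Finset.univ.filter fun i => p i ≠ none).card ≤ d) :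
    (SN v A : ℝ) * lam ^ d ≤ (1 + lam * q) ^ (Fintype.card ι) := by
  have key : ∑ p : ι → Option (Fin q), ∏ i, (if p i ≠ none then lam else 1)
      = (1 + lam * q) ^ (Fintype.card ι) := by
    have := (Finset.prod_univ_sum (fun _ : ι => (Finset.univ : Finset (Option (Fin q))))
      (fun _ o => if o ≠ none then lam else (1 : ℝ))).symm
    rw [Fintype.piFinset_univ] at this
    rw [this]
    simp [Fintype.sum_option, mul_comm]
  rw [← key]
  unfold SN
  rw [← nsmul_eq_mul]
  refine (Finset.card_nsmul_le_sum _ (fun p : ι → Option (Fin q) =>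
    ∏ i, (if p i ≠ none then lam else 1)) _ fun p hp => ?_).trans
    (Finset.sum_le_sum_of_subset_of_nonneg (Finset.filter_subset _ _) ?_)
  · rw [Finset.prod_ite]
    simp only [Finset.prod_const, one_pow, mul_one]
    exact pow_le_pow_of_le_one h0.le h1 (hd p (Finset.mem_filter.1 hp).2)
  · intro p _ _
    refine Finset.prod_nonneg fun i _ => ?_
    split_ifs <;> linarith

open Classical in
lemma subsample {α : Type*} (G : Finset α) (N : ℕ) (hN : 0 < N) (β : ℝ)
    (E : α → α → Finset (Fin N))
    (hE : ∀ f ∈ G, ∀ g ∈ G, f ≠ g → β * N < (E f g).card) (n : ℕ)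
    (hn : (G.card : ℝ) ^ 2 ≤ Real.exp (β * n / 4)) :
    ∃ τ : Fin n → Fin N, ∀ f ∈ G, ∀ g ∈ G, f ≠ g →
      β * n / 4 ≤ ((Finset.univ.filter fun i => τ i ∈ E f g).card : ℝ) := by
  set W : (Fin n → Fin N) → α → α → ℝ := fun τ f g =>
    if f = g then 0 else ∏ i, (if τ i ∈ E f g then (1/2 : ℝ) else 1) with hW
  have hW0 : ∀ τ f g, 0 ≤ W τ f g := by
    intro τ f g
    simp only [hW]
    split_ifs
    · exact le_rfl
    · exact Finset.prod_nonneg fun i _ => by split_ifs <;> norm_num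
  have hNr : (0 : ℝ) < N := by exact_mod_cast hN
  have hWs : ∀ f ∈ G, ∀ g ∈ G, ∑ τ, W τ f g ≤ (N : ℝ) ^ n * Real.exp (-(β * n / 2)) := by
    intro f hf g hg
    by_cases hfg : f = g
    · simp only [hW, hfg, if_true, Finset.sum_const_zero]; positivity
    · simp only [hW, hfg, if_false]
      have := (Finset.prod_univ_sum (fun _ : Fin n => (Finset.univ : Finset (Fin N)))
        (fun _ o => if o ∈ E f g then (1/2 : ℝ) else (1 : ℝ))).symm
      rw [Fintype.piFinset_univ] at this
      rw [this, Finset.prod_const, Finset.card_univ, Fintype.card_fin]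
      have hs : ∑ o : Fin N, (if o ∈ E f g then (1/2 : ℝ) else (1 : ℝ))
          = N - (E f g).card / 2 := by
        have h1 : ∀ o : Fin N, (if o ∈ E f g then (1/2 : ℝ) else (1 : ℝ))
            = 1 - (if o ∈ E f g then (1/2 : ℝ) else 0) := by
          intro o; split_ifs <;> norm_num
        simp_rw [h1, Finset.sum_sub_distrib, Finset.sum_ite_mem]
        simp
        ring
      rw [hs]
      have hle : (N : ℝ) - (E f g).card / 2 ≤ N * Real.exp (-(β / 2)) := by
        have h1 := Real.add_one_le_exp (-(β / 2))
        have h2 := hE f hf g hg hfg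
        nlinarith
      have hnn : 0 ≤ (N : ℝ) - (E f g).card / 2 := by
        have : (E f g).card ≤ N := by simpa using Finset.card_le_univ (E f g)
        have : ((E f g).card : ℝ) ≤ N := by exact_mod_cast this
        linarith
      calc ((N : ℝ) - (E f g).card / 2) ^ n ≤ (N * Real.exp (-(β / 2))) ^ n :=
            pow_le_pow_left₀ hnn hle n
        _ = _ := by
            rw [mul_pow, ← Real.exp_nat_mul]
            congr 2; ring
  have htot : ∑ τ : Fin n → Fin N, ∑ f ∈ G, ∑ g ∈ G, W τ f g
      ≤ ∑ τ : Fin n → Fin N, (G.card : ℝ) ^ 2 * Real.exp (-(β * n / 2)) := by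
    rw [Finset.sum_comm]
    have : ∀ f ∈ G, ∑ τ : Fin n → Fin N, ∑ g ∈ G, W τ f g
        ≤ G.card * ((N : ℝ) ^ n * Real.exp (-(β * n / 2))) := by
      intro f hf
      rw [Finset.sum_comm, ← nsmul_eq_mul]
      exact Finset.sum_le_card_nsmul _ _ _ fun g hg => hWs f hf g hg
    refine (Finset.sum_le_card_nsmul _ _ _ this).trans (le_of_eq ?_)
    simp
    ring
  have hne : (Finset.univ : Finset (Fin n → Fin N)).Nonempty := ⟨fun _ => ⟨0, hN⟩, Finset.mem_univ _⟩
  obtain ⟨τ, _, hτ⟩ := Finset.exists_le_of_sum_le hne htot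
  refine ⟨τ, fun f hf g hg hfg => ?_⟩
  have h1 : W τ f g ≤ Real.exp (-(β * n / 4)) := by
    calc W τ f g ≤ ∑ g ∈ G, W τ f g :=
          Finset.single_le_sum (f := fun g => W τ f g) (fun g _ => hW0 τ f g) hg
      _ ≤ ∑ f ∈ G, ∑ g ∈ G, W τ f g :=
          Finset.single_le_sum (f := fun f => ∑ g ∈ G, W τ f g)
            (fun f _ => Finset.sum_nonneg fun g _ => hW0 τ f g) hf
      _ ≤ (G.card : ℝ) ^ 2 * Real.exp (-(β * n / 2)) := hτ
      _ ≤ Real.exp (β * n / 4) * Real.exp (-(β * n / 2)) := by gcongr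
      _ = _ := by rw [← Real.exp_add]; congr 1; ring
  simp only [hW, hfg, if_false] at h1
  rw [Finset.prod_ite] at h1
  simp only [Finset.prod_const, one_pow, mul_one] at h1
  set Z := (Finset.univ.filter fun i => τ i ∈ E f g).card
  have h2 : Real.exp (-(Z : ℝ)) ≤ (1 / 2 : ℝ) ^ Z := by
    have : Real.exp (-(Z : ℝ)) = (Real.exp (-1)) ^ Z := by
      rw [← Real.exp_nat_mul]; congr 1; ring
    rw [this]
    refine pow_le_pow_left₀ (Real.exp_pos _).le ?_ _
    rw [Real.exp_neg, one_div]
    apply inv_anti₀ (by norm_num)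
    have := Real.add_one_le_exp (1 : ℝ)
    linarith
  have h3 := Real.exp_le_exp.1 (h2.trans h1)
  linarith

lemma final_arith (M d n q : ℕ) (η β lM : ℝ) (hη : 0 < η) (hη1 : η < 1) (hβ : 0 < β) (hβ1 : β < 1)
    (hd : 1 ≤ d) (hM : 1 ≤ M) (hlM : lM = Real.log M)
    (hdn : d ≤ n) (hn : (n : ℝ) ≤ 9 * (lM + d) / β) (hq1 : 1 ≤ q)
    (hq : (q : ℝ) ≤ 21 / (η * β)) (S : ℕ) (hS : M ≤ S ^ 2)
    (hSd : (S : ℝ) * ((d : ℝ) / (n * q)) ^ d ≤ (1 + (d : ℝ) / (n * q) * q) ^ n) :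
    (M : ℝ) ≤ (2 / (η * β)) ^ ((50 : ℝ) * d) := by
  have hd0 : (0 : ℝ) < d := by exact_mod_cast hd
  have hn0 : (0 : ℝ) < n := by exact_mod_cast (lt_of_lt_of_le hd hdn)
  have hq0 : (0 : ℝ) < q := by exact_mod_cast hq1
  have hM0 : (0 : ℝ) < M := by exact_mod_cast hM
  have hM1 : (1 : ℝ) ≤ M := by exact_mod_cast hM
  have hlM0 : 0 ≤ lM := by rw [hlM]; exact Real.log_nonneg hM1
  have hS0 : (0 : ℝ) < S := by
    have : 0 < S := by
      rcases Nat.eq_zero_or_pos S with h | h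
      · rw [h] at hS; simp at hS; omega
      · exact h
    exact_mod_cast this
  have hηβ : 0 < η * β := mul_pos hη hβ
  set u := 1 / (η * β) with hu
  have hu0 : 0 < u := by positivity
  have hβu : 1 / β ≤ u := by
    rw [hu]
    apply one_div_le_one_div_of_le hηβ
    nlinarith
  have hu1 : 1 ≤ u := by
    rw [hu, le_div_iff₀ hηβ]; nlinarith
  have hexp : (1 + (d : ℝ) / (n * q) * q) ^ n ≤ Real.exp d := by
    have h1 : 1 + (d : ℝ) / (n * q) * q ≤ Real.exp (d / n) := by
      have := Real.add_one_le_exp ((d : ℝ) / n)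
      have e : (d : ℝ) / (n * q) * q = d / n := by field_simp
      rw [e]; linarith
    calc (1 + (d : ℝ) / (n * q) * q) ^ n ≤ Real.exp (d / n) ^ n :=
          pow_le_pow_left₀ (by positivity) h1 n
      _ = Real.exp d := by
          rw [← Real.exp_nat_mul]; congr 1; field_simp
  have hpos : (0 : ℝ) < (d : ℝ) / (n * q) := by positivity
  have hlog : Real.log S + d * Real.log ((d : ℝ) / (n * q)) ≤ d := by
    have := Real.log_le_log (by positivity) (hSd.trans hexp)
    rwa [Real.log_mul hS0.ne' (by positivity), Real.log_pow, Real.log_exp] at this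
  have hMS : lM ≤ 2 * Real.log S := by
    rw [hlM]
    have : (M : ℝ) ≤ (S : ℝ) ^ 2 := by exact_mod_cast hS
    have := Real.log_le_log hM0 this
    rwa [Real.log_pow] at this
  set x := lM / d with hx
  have hx0 : 0 ≤ x := by positivity
  have hlx : lM = x * d := by rw [hx]; field_simp
  have hnq : (n * q : ℝ) / d ≤ 189 * u ^ 2 * (x + 1) := by
    rw [div_le_iff₀ hd0]
    calc (n * q : ℝ) ≤ (9 * (lM + d) / β) * (21 / (η * β)) := by gcongr
      _ = 189 * u * (1 / β) * (lM + d) := by rw [hu]; ring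
      _ ≤ 189 * u * u * (lM + d) := by gcongr
      _ = _ := by rw [hlx]; ring
  have hlnq : Real.log ((n * q : ℝ) / d) ≤ Real.log 189 + 2 * Real.log u + Real.log (x + 1) := by
    have := Real.log_le_log (by positivity) hnq
    rwa [Real.log_mul (by positivity) (by positivity), Real.log_mul (by positivity) (by positivity),
      Real.log_pow] at this
  have hinv : Real.log ((d : ℝ) / (n * q)) = - Real.log ((n * q : ℝ) / d) := by
    rw [← Real.log_inv, inv_div]
  have hL : (1 / 2 : ℝ) < Real.log 2 := by have := Real.log_two_gt_d9; linarith
  have h189 : Real.log 189 ≤ 8 * Real.log 2 := by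
    have : Real.log 189 ≤ Real.log ((2 : ℝ) ^ 8) := Real.log_le_log (by norm_num) (by norm_num)
    rwa [Real.log_pow] at this
  have hx1 : Real.log (x + 1) ≤ (x + 1) / 4 - 1 + 2 * Real.log 2 := by
    have h := Real.log_le_sub_one_of_pos (show 0 < (x + 1) / 4 by positivity)
    rw [Real.log_div (by positivity) (by norm_num)] at h
    have : Real.log 4 = 2 * Real.log 2 := by
      rw [show (4 : ℝ) = 2 ^ 2 by norm_num, Real.log_pow]; norm_num
    linarith
  have hxd : x * d ≤ (2 + 2 * Real.log ((n * q : ℝ) / d)) * d := by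
    rw [← hlx]; rw [hinv] at hlog; nlinarith
  have hxb := le_of_mul_le_mul_right hxd hd0
  have hlu : 0 ≤ Real.log u := Real.log_nonneg hu1
  have hxf : x ≤ 50 * (Real.log 2 + Real.log u) := by linarith
  have h2u : 2 / (η * β) = 2 * u := by rw [hu]; ring
  rw [h2u, ← Real.log_le_log_iff hM0 (by positivity), Real.log_rpow (by positivity),
    Real.log_mul (by norm_num) hu0.ne', ← hlM, hlx]
  nlinarith

lemma fat_of_shat {X α : Type*} (F : Set (X → ℝ)) (G : Finset α) (e : α → X → ℝ)
    (hG : ∀ f ∈ G, e f ∈ F)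
    {n q : ℕ} (y : Fin n → X) (s : ℝ) (hs : 0 < s) (v : α → Fin n → Fin q)
    (hv1 : ∀ f ∈ G, ∀ i, ((v f i : ℕ) : ℝ) * s ≤ e f (y i))
    (hv2 : ∀ f ∈ G, ∀ i, e f (y i) < (((v f i : ℕ) : ℝ) + 1) * s)
    (p : Fin n → Option (Fin q)) (hp : Shat v G p) :
    FatShattered F (s / 2) (Finset.univ.filter fun i => p i ≠ none).card := by
  classical
  set T := Finset.univ.filter fun i => p i ≠ none with hT
  let φ := T.equivFin.symm
  have hlev : ∀ k, ∃ j, p (φ k : Fin n) = some j := fun k =>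
    Option.ne_none_iff_exists'.1 (Finset.mem_filter.1 (φ k).2).2
  choose j hj using hlev
  refine ⟨fun k => y (φ k), fun k => ((j k : ℕ) + 1 / 2) * s, fun b => ?_⟩
  obtain ⟨f, hf, h⟩ := hp (fun i => if hi : i ∈ T then b (φ.symm ⟨i, hi⟩) else true)
  refine ⟨e f, hG f hf, fun k => ?_⟩
  have hk := h (φ k) (j k) (hj k)
  have hb : (if hi : (φ k : Fin n) ∈ T then b (φ.symm ⟨(φ k : Fin n), hi⟩) else true) = b k := by
    rw [dif_pos (φ k).2]; simp
  rw [hb] at hk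
  refine ⟨fun hbt => ?_, fun hbf => ?_⟩
  · have h1 : (j k : ℕ) + 1 ≤ (v f (φ k) : ℕ) := hk.1 hbt
    have h1 : ((j k : ℕ) : ℝ) + 1 ≤ ((v f (φ k) : ℕ) : ℝ) := by exact_mod_cast h1
    have h2 := hv1 f hf (φ k)
    simp only
    nlinarith
  · have h1 : (v f (φ k) : ℕ) + 1 ≤ (j k : ℕ) := hk.2 hbf
    have h1 : ((v f (φ k) : ℕ) : ℝ) + 1 ≤ ((j k : ℕ) : ℝ) := by exact_mod_cast h1
    have h2 := hv2 f hf (φ k)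
    simp only
    nlinarith

lemma between_card {q : ℕ} (a b : Fin q) (k : ℝ) (h : (a : ℝ) + k + 1 ≤ (b : ℝ)) :
    k ≤ ((∑ j : Fin q, if a < j ∧ j < b then 1 else 0 : ℕ) : ℝ) := by
  have : (∑ j : Fin q, if a < j ∧ j < b then 1 else 0 : ℕ) = (Finset.Ioo a b).card := by
    rw [Finset.card_eq_sum_ones, ← Finset.sum_filter]
    congr 1
    ext j; simp
  rw [this, Fin.card_Ioo]
  have h2 : (b : ℕ) ≤ ((b : ℕ) - (a : ℕ) - 1) + a + 1 := by omega
  have h3 : ((b : ℕ) : ℝ) ≤ (((b : ℕ) - (a : ℕ) - 1 : ℕ) : ℝ) + a + 1 := by exact_mod_cast h2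
  linarith

lemma packing_bound {X : Type} (F : Set (X → ℝ)) (hF : ∀ f ∈ F, ∀ z, f z ∈ Set.Icc (0 : ℝ) 1)
    (η β : ℝ) (hη : 0 < η) (hη1 : η < 1) (hβ : 0 < β) (hβ1 : β < 1)
    (m : ℕ) (hm : 0 < m) (w : Fin (2 * m) → X) (d : ℕ)
    (hd : ∀ k, FatShattered F (1 / 40 * η * β) k → k ≤ d)
    (G : Finset (X → ℝ)) (hG : ∀ f ∈ G, f ∈ F)
    (hsep : ∀ f ∈ G, ∀ g ∈ G, f ≠ g → β < empDist (2 * m) w η f g) :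
    (G.card : ℝ) ≤ (2 / (η * β)) ^ ((50 : ℝ) * d) := by
  classical
  have hηβ : 0 < η * β := mul_pos hη hβ
  have hηβ1 : η * β < 1 := by nlinarith
  have hbase : 1 ≤ 2 / (η * β) := by rw [le_div_iff₀ hηβ]; linarith
  rcases Nat.lt_or_ge G.card 2 with h2 | h2
  · have h1 : (G.card : ℝ) ≤ 1 := by exact_mod_cast Nat.lt_succ_iff.1 h2
    exact h1.trans (Real.one_le_rpow hbase (by positivity))
  set lM := Real.log G.card with hlM
  have hM2 : (2 : ℝ) ≤ G.card := by exact_mod_cast h2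
  have hlM0 : 0 < lM := Real.log_pos (by linarith)
  set n := ⌈8 * (lM + d) / β⌉₊ with hn
  have hn1 : 8 * (lM + d) / β ≤ n := Nat.le_ceil _
  have hn2 : (n : ℝ) < 8 * (lM + d) / β + 1 := Nat.ceil_lt_add_one (by positivity)
  have hn1' : 8 * (lM + d) ≤ n * β := by rwa [div_le_iff₀ hβ] at hn1
  have hn0 : (0 : ℝ) < n := by
    refine lt_of_lt_of_le ?_ hn1
    positivity
  have hNpos : (0 : ℝ) < ((2 * m : ℕ) : ℝ) := by exact_mod_cast (by omega : 0 < 2 * m)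
  obtain ⟨τ, hτ⟩ := subsample G (2 * m) (by omega) β
    (fun f g => Finset.univ.filter fun j => η < |f (w j) - g (w j)|)
    (by
      intro f hf g hg hfg
      have := hsep f hf g hg hfg
      unfold empDist at this
      rwa [lt_div_iff₀ hNpos] at this) n
    (by
      rw [← Real.exp_log (show (0:ℝ) < (G.card : ℝ) ^ 2 by positivity), Real.log_pow]
      apply Real.exp_le_exp.2
      push_cast
      have : (0 : ℝ) ≤ d := by positivity
      rw [← hlM]
      nlinarith)
  set s := η * β / 20 with hs
  have hs0 : 0 < s := by positivity
  set q := ⌊1 / s⌋₊ + 1 with hq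
  have hlt : ∀ r : ℝ, min ⌊r / s⌋₊ (q - 1) < q := by
    intro r
    have : q - 1 < q := by omega
    exact lt_of_le_of_lt (min_le_right _ _) this
  let v : (X → ℝ) → Fin n → Fin q := fun f i => ⟨min ⌊f (w (τ i)) / s⌋₊ (q - 1), hlt _⟩
  have hv : ∀ f ∈ G, ∀ i, (v f i : ℕ) = ⌊f (w (τ i)) / s⌋₊ := by
    intro f hf i
    have := hF f (hG f hf) (w (τ i))
    refine min_eq_left ?_
    simp only [hq, Nat.add_sub_cancel]
    apply Nat.floor_le_floor
    gcongr
    exact this.2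
  have hv1 : ∀ f ∈ G, ∀ i, ((v f i : ℕ) : ℝ) * s ≤ f (w (τ i)) := by
    intro f hf i
    rw [hv f hf i, ← le_div_iff₀ hs0]
    exact Nat.floor_le (div_nonneg (hF f (hG f hf) _).1 hs0.le)
  have hv2 : ∀ f ∈ G, ∀ i, f (w (τ i)) < (((v f i : ℕ) : ℝ) + 1) * s := by
    intro f hf i
    rw [hv f hf i, ← div_lt_iff₀ hs0]
    exact Nat.lt_floor_add_one _
  have hbtw : ∀ f ∈ G, ∀ g ∈ G, ∀ i, η < f (w (τ i)) - g (w (τ i)) →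
      18 / β ≤ ((∑ j : Fin q, if v g i < j ∧ j < v f i then 1 else 0 : ℕ) : ℝ) := by
    intro f hf g hg i hi
    apply between_card
    have a1 := hv2 f hf i
    have a2 := hv1 g hg i
    have a3 : η < (((v f i : ℕ) : ℝ) + 1 - ((v g i : ℕ) : ℝ)) * s := by nlinarith
    have a4 : 20 / β * s = η := by rw [hs]; field_simp
    have a5 : 20 / β < ((v f i : ℕ) : ℝ) + 1 - ((v g i : ℕ) : ℝ) := by
      rw [← a4] at a3
      exact lt_of_mul_lt_mul_right a3 hs0.le
    have a6 : 1 ≤ 1 / β := by rw [le_div_iff₀ hβ]; linarith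
    have a7 : 20 / β = 18 / β + 2 * (1 / β) := by ring
    linarith
  have hD : ∀ f ∈ G, ∀ g ∈ G, f ≠ g → 4 * Fintype.card (Fin n) < DN v f g + DN v g f := by
    intro f hf g hg hfg
    have hZ := hτ f hf g hg hfg
    set Z := Finset.univ.filter fun i => τ i ∈
      (Finset.univ.filter fun j => η < |f (w j) - g (w j)|) with hZdef
    have hsum : (Z.card : ℝ) * (18 / β) ≤ ((DN v f g + DN v g f : ℕ) : ℝ) := by
      unfold DN
      rw [← Finset.sum_add_distrib, Nat.cast_sum, ← nsmul_eq_mul]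
      refine (Finset.card_nsmul_le_sum Z (fun i =>
        (((∑ j : Fin q, if v f i < j ∧ j < v g i then 1 else 0) +
          (∑ j : Fin q, if v g i < j ∧ j < v f i then 1 else 0) : ℕ) : ℝ)) _ ?_).trans
        (Finset.sum_le_sum_of_subset_of_nonneg (Finset.subset_univ Z)
          (fun _ _ _ => Nat.cast_nonneg _))
      intro i hi
      simp only [hZdef, Finset.mem_filter, Finset.mem_univ, true_and] at hi
      rw [Nat.cast_add]
      rcases lt_abs.1 hi with h | h
      · exact (hbtw f hf g hg i h).trans (le_add_of_nonneg_left (Nat.cast_nonneg _))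
      · exact (hbtw g hg f hf i (by linarith)).trans (le_add_of_nonneg_right (Nat.cast_nonneg _))
    have h4 : β * n / 4 * (18 / β) ≤ (Z.card : ℝ) * (18 / β) := by gcongr
    have h5 : β * n / 4 * (18 / β) = 18 / 4 * n := by field_simp
    rw [Fintype.card_fin]
    have h6 : ((4 * n : ℕ) : ℝ) < ((DN v f g + DN v g f : ℕ) : ℝ) := by
      push_cast at hsum ⊢
      linarith
    exact_mod_cast h6
  have hSM := card_le_SN_sq v G.card G rfl hD
  have hsupp : ∀ p, Shat v G p → (Finset.univ.filter fun i => p i ≠ none).card ≤ d := by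
    intro p hp
    apply hd
    have := fat_of_shat F G (fun f => f) hG (fun i => w (τ i)) s hs0 v hv1 hv2 p hp
    have e : s / 2 = 1 / 40 * η * β := by rw [hs]; ring
    rwa [e] at this
  rcases Nat.eq_zero_or_pos d with hd0 | hd0
  · exfalso
    have hle : SN v G ≤ 1 := by
      unfold SN
      rw [Finset.card_le_one]
      have : ∀ p, Shat v G p → p = fun _ => none := by
        intro p hp
        have h := hsupp p hp
        rw [hd0, Nat.le_zero, Finset.card_eq_zero] at h
        funext i
        by_contra hne
        have : i ∈ (Finset.univ.filter fun i => p i ≠ none) := by simpa using hne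
        rw [h] at this
        simp at this
      intro a ha b hb
      rw [this a (Finset.mem_filter.1 ha).2, this b (Finset.mem_filter.1 hb).2]
    have := Nat.pow_le_pow_left hle 2
    omega
  · have hdr : (0 : ℝ) < d := by exact_mod_cast hd0
    have hdn : d ≤ n := by
      have : (d : ℝ) ≤ n := by nlinarith
      exact_mod_cast this
    have hq1 : 1 ≤ q := by omega
    have hqr : (1 : ℝ) ≤ q := by exact_mod_cast hq1
    have hSd := SN_le_of_supp v G d ((d : ℝ) / (n * q)) (by positivity)
      (by
        rw [div_le_one (by positivity)]
        have : (d : ℝ) ≤ n := by exact_mod_cast hdn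
        nlinarith) hsupp
    rw [Fintype.card_fin] at hSd
    have hb1 : 1 ≤ 1 / β := by rw [le_div_iff₀ hβ]; linarith
    have hd1 : (1 : ℝ) ≤ d := by exact_mod_cast hd0
    refine final_arith G.card d n q η β lM hη hη1 hβ hβ1 hd0 (by omega) hlM hdn ?_ hq1 ?_
      (SN v G) hSM hSd
    · have : 1 ≤ (lM + d) / β := by rw [le_div_iff₀ hβ]; linarith
      have e : 9 * (lM + d) / β = 8 * (lM + d) / β + (lM + d) / β := by ring
      linarith
    · have h1 : ((⌊1 / s⌋₊ : ℕ) : ℝ) ≤ 1 / s := Nat.floor_le (by positivity)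
      have h3 : 1 / s = 20 / (η * β) := by rw [hs]; field_simp
      have h4 : 1 ≤ 1 / (η * β) := by rw [le_div_iff₀ hηβ]; linarith
      have e : 21 / (η * β) = 20 / (η * β) + 1 / (η * β) := by ring
      rw [hq]
      push_cast
      linarith

/-- there are universal constants c, c' such that for any class
F of [0,1]-valued functions with (c'ηβ)-fat-shattering dimension at most d, the
β-covering number of F under ρ_η (w.r.t. any empirical measure on 2m points)
satisfies N_η(β) ≤ (2/(ηβ))^{c·d}. -/
theorem stmt11 : ∃ c c' : ℝ, 0 < c ∧ 0 < c' ∧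
    ∀ (X : Type) (F : Set (X → ℝ)), (∀ f ∈ F, ∀ z, f z ∈ Set.Icc (0 : ℝ) 1) →
    ∀ η β : ℝ, 0 < η → η < 1 → 0 < β → β < 1 →
    ∀ m : ℕ, 0 < m → ∀ w : Fin (2 * m) → X,
    ∀ d : ℕ, (∀ k, FatShattered F (c' * η * β) k → k ≤ d) →
    covN F (empDist (2 * m) w η) β
      ≤ ENNReal.ofReal ((2 / (η * β)) ^ (c * d)) := by
  classical
  refine ⟨50, 1 / 40, by norm_num, by norm_num, ?_⟩
  intro X F hF η β hη hη1 hβ hβ1 m hm w d hd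
  set K := (2 / (η * β)) ^ ((50 : ℝ) * d) with hK
  let Pk : ℕ → Prop := fun k => ∃ G : Finset (X → ℝ), G.card = k ∧ (∀ f ∈ G, f ∈ F) ∧
    ∀ f ∈ G, ∀ g ∈ G, f ≠ g → β < empDist (2 * m) w η f g
  have hPb : ∀ k, Pk k → k ≤ ⌊K⌋₊ := by
    rintro k ⟨G, rfl, h1, h2⟩
    exact Nat.le_floor (packing_bound F hF η β hη hη1 hβ hβ1 m hm w d hd G h1 h2)
  have hP0 : Pk 0 := ⟨∅, by simp⟩
  obtain ⟨G, hGc, hGF, hGs⟩ : Pk (Nat.findGreatest Pk ⌊K⌋₊) :=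
    Nat.findGreatest_spec (Nat.zero_le _) hP0
  have hGK := packing_bound F hF η β hη hη1 hβ hβ1 m hm w d hd G hGF hGs
  have hsymm : ∀ f g, empDist (2 * m) w η f g = empDist (2 * m) w η g f := by
    intro f g
    unfold empDist
    simp_rw [abs_sub_comm]
  have hself : ∀ f, empDist (2 * m) w η f f = 0 := by
    intro f
    unfold empDist
    simp [hη.le]
  unfold covN
  refine le_trans (b := (G.card : ℝ≥0∞)) (sInf_le ⟨G, rfl, ?_⟩) ?_
  · intro f hf
    by_contra hcon
    push Not at hcon
    have hfG : f ∉ G := by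
      intro hfG
      have := hcon f hfG
      rw [hself] at this
      linarith
    have hbig : Pk (G.card + 1) := by
      refine ⟨insert f G, Finset.card_insert_of_notMem hfG, ?_, ?_⟩
      · intro g hg
        rcases Finset.mem_insert.1 hg with rfl | hg
        · exact hf
        · exact hGF g hg
      · intro a ha b hb hab
        rcases Finset.mem_insert.1 ha with rfl | ha2 <;> rcases Finset.mem_insert.1 hb with rfl | hb2
        · exact absurd rfl hab
        · exact hcon b hb2
        · rw [hsymm]; exact hcon a ha2
        · exact hGs a ha2 b hb2 hab
    have := Nat.le_findGreatest (hPb _ hbig) hbig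
    omega
  · rw [← ENNReal.ofReal_natCast]
    exact ENNReal.ofReal_le_ofReal hGK
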